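/- Let k be a field, let R1 and R2 be nonzero commutative noetherian k-algebras, let C1 be a semidualizing R1-module and C2 a semidualizing R2-module (so that C1 ⊗_k C2 is a semidualizing (R1 ⊗_k R2)-module), and let N1 be a finitely generated R1-module and N2 a finitely generated R2-module. If N1 is totally C1-reflexive and N2 is totally C2-reflexive, then N1 ⊗_k N2 is totally (C1 ⊗_k C2)-reflexive. Conversely, if N1 ≠ 0 and N2 ≠ 0 and N1 ⊗_k N2 is totally (C1 ⊗_k C2)-reflexive, then N1 is totally C1-reflexive and N2 is totally C2-reflexive. -/

import Mathlib

open TensorProduct CategoryTheory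

section TensorModule

variable (k : Type) [CommRing k] (R1 R2 : Type) [CommRing R1] [CommRing R2]
  [Algebra k R1] [Algebra k R2]
variable (M1 M2 : Type) [AddCommGroup M1] [Module k M1] [Module R1 M1] [IsScalarTower k R1 M1]
  [AddCommGroup M2] [Module k M2] [Module R2 M2] [IsScalarTower k R2 M2]

/-- The action of `R2` on `M1 ⊗[k] M2` through the right factor, as an algebra morphism
to endomorphisms. -/
noncomputable def rightSMul : R2 →ₐ[k] Module.End k (M1 ⊗[k] M2) :=
  ((Module.endTensorEndAlgHom (R := k) (S := k) (A := k) (M := M1) (N := M2)).comp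
      (Algebra.TensorProduct.includeRight (R := k) (A := Module.End k M1))).comp
    (Algebra.lsmul k k M2 (A := R2))

/-- The `R2`-module structure on `M1 ⊗[k] M2` via the right factor. -/
noncomputable def rightModule : Module R2 (M1 ⊗[k] M2) :=
  Module.compHom _ (rightSMul k R2 M1 M2).toRingHom

/-- The `R1 ⊗[k] R2`-module structure on `M1 ⊗[k] M2`, characterized by
`(r1 ⊗ r2) • (m1 ⊗ m2) = (r1 • m1) ⊗ (r2 • m2)`; see `tensorModule_smul_tmul`. -/
noncomputable instance (priority := 10) tensorModule :
    Module (R1 ⊗[k] R2) (M1 ⊗[k] M2) :=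
  letI m2 : Module R2 (M1 ⊗[k] M2) := rightModule k R2 M1 M2
  haveI t2 : IsScalarTower k R2 (M1 ⊗[k] M2) := by
    refine IsScalarTower.of_algebraMap_smul (fun r x => ?_)
    show (rightSMul k R2 M1 M2) (algebraMap k R2 r) x = r • x
    rw [AlgHom.commutes]
    simp [Module.algebraMap_end_apply]
  haveI sc : SMulCommClass R1 R2 (M1 ⊗[k] M2) := by
    constructor
    intro r1 r2 x
    show r1 • (rightSMul k R2 M1 M2 r2) x = (rightSMul k R2 M1 M2 r2) (r1 • x)
    induction x using TensorProduct.induction_on with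
    | zero => simp
    | tmul m n =>
        have h1 : (rightSMul k R2 M1 M2 r2) (m ⊗ₜ[k] n) = m ⊗ₜ[k] (r2 • n) := rfl
        have h2 : (rightSMul k R2 M1 M2 r2) ((r1 • m) ⊗ₜ[k] n) = (r1 • m) ⊗ₜ[k] (r2 • n) := rfl
        rw [h1, smul_tmul', smul_tmul', h2]
    | add x y hx hy =>
        calc r1 • (rightSMul k R2 M1 M2 r2) (x + y)
            = r1 • ((rightSMul k R2 M1 M2 r2) x + (rightSMul k R2 M1 M2 r2) y) := by
              rw [(rightSMul k R2 M1 M2 r2).map_add]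
          _ = r1 • (rightSMul k R2 M1 M2 r2) x + r1 • (rightSMul k R2 M1 M2 r2) y :=
              smul_add _ _ _
          _ = (rightSMul k R2 M1 M2 r2) (r1 • x) + (rightSMul k R2 M1 M2 r2) (r1 • y) := by
              rw [hx, hy]
          _ = (rightSMul k R2 M1 M2 r2) (r1 • x + r1 • y) :=
              ((rightSMul k R2 M1 M2 r2).map_add _ _).symm
          _ = (rightSMul k R2 M1 M2 r2) (r1 • (x + y)) := by rw [smul_add]
  TensorProduct.Algebra.module

/-- The defining property of the `R1 ⊗[k] R2`-module structure on `M1 ⊗[k] M2`. -/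
lemma tensorModule_smul_tmul (r1 : R1) (r2 : R2) (m : M1) (n : M2) :
    (r1 ⊗ₜ[k] r2 : R1 ⊗[k] R2) • (m ⊗ₜ[k] n : M1 ⊗[k] M2) = (r1 • m) ⊗ₜ[k] (r2 • n) := rfl

end TensorModule

section HomAlg

variable (R : Type) [CommRing R]

/-- The `i`-th Ext group `Ext_R^i(M, N)`. -/
noncomputable def extGroup (M N : Type) [AddCommGroup M] [Module R M]
    [AddCommGroup N] [Module R N] (i : ℕ) : Type :=
  (((Ext R (ModuleCat R) i).obj (Opposite.op (ModuleCat.of R M))).obj (ModuleCat.of R N) :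
    ModuleCat R)

/-- The `i`-th Tor group `Tor_i^R(M, N)`. -/
noncomputable def torGroup (M N : Type) [AddCommGroup M] [Module R M]
    [AddCommGroup N] [Module R N] (i : ℕ) : Type :=
  (((Tor (ModuleCat R) i).obj (ModuleCat.of R M)).obj (ModuleCat.of R N) : ModuleCat R)

/-- `C` is a semidualizing `R`-module: it is finitely generated, the homothety map
`R → Hom_R(C,C)`, `r ↦ (x ↦ r • x)`, is bijective, and `Ext_R^i(C,C) = 0` for all `i > 0`. -/
noncomputable def IsSemidualizing (C : Type) [AddCommGroup C] [Module R C] : Prop :=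
  Module.Finite R C ∧
  Function.Bijective (LinearMap.lsmul R C) ∧
  ∀ i : ℕ, 0 < i → Subsingleton (extGroup R C C i)

end HomAlg

section Reflexive

variable (R : Type) [CommRing R]

/-- `M` is totally `C`-reflexive: the biduality map `M → Hom_R(Hom_R(M,C),C)`,
`m ↦ (f ↦ f m)`, is bijective and `Ext_R^i(M,C) = 0 = Ext_R^i(Hom_R(M,C),C)`
for all `i > 0`.  (The statement also requires `M` to be finitely generated.) -/
noncomputable def IsTotallyReflexive (C M : Type) [AddCommGroup C] [Module R C]
    [AddCommGroup M] [Module R M] : Prop :=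
  Function.Bijective
    (((LinearMap.id : (M →ₗ[R] C) →ₗ[R] (M →ₗ[R] C)).flip) : M →ₗ[R] ((M →ₗ[R] C) →ₗ[R] C)) ∧
  (∀ i : ℕ, 0 < i → Subsingleton (extGroup R M C i)) ∧
  (∀ i : ℕ, 0 < i → Subsingleton (extGroup R (M →ₗ[R] C) C i))

end Reflexive


section ExtVanishing

variable {R : Type} [CommRing R]

lemma subsingleton_extGroup_succ_iff (M C : Type) [AddCommGroup M] [Module R M]
    [AddCommGroup C] [Module R C] (n : ℕ) :
    Subsingleton (extGroup R M C (n + 1)) ↔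
      Subsingleton (Abelian.Ext (ModuleCat.of R M) (ModuleCat.of R C) (n + 1)) := by
  let P := ProjectiveResolution.of (ModuleCat.of R M)
  have h1 : Subsingleton (extGroup R M C (n + 1)) ↔
      ∀ f : P.complex.X (n + 1) ⟶ ModuleCat.of R C, P.complex.d (n + 2) (n + 1) ≫ f = 0 →
        ∃ g : P.complex.X n ⟶ ModuleCat.of R C, P.complex.d (n + 1) n ≫ g = f := by
    have e := P.isoExt (R := R) (n + 1) (ModuleCat.of R C)
    have : Subsingleton (extGroup R M C (n + 1)) ↔
        Limits.IsZero (((Ext R (ModuleCat R) (n + 1)).obj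
          (Opposite.op (ModuleCat.of R M))).obj (ModuleCat.of R C)) :=
      (ModuleCat.isZero_iff_subsingleton).symm
    rw [this, e.isZero_iff, ← HomologicalComplex.exactAt_iff_isZero_homology,
      HomologicalComplex.exactAt_iff' _ n (n + 1) (n + 2) (by simp) (by simp),
      ShortComplex.moduleCat_exact_iff]
    rfl
  rw [h1]
  constructor
  · intro h
    refine subsingleton_of_forall_eq 0 fun x => ?_
    obtain ⟨f, hf, rfl⟩ := P.extMk_surjective x (n + 2) rfl
    exact (P.extMk_eq_zero_iff f _ rfl hf n rfl).2 (h f hf)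
  · intro h f hf
    exact (P.extMk_eq_zero_iff f _ rfl hf n rfl).1 (Subsingleton.elim _ _)

/-- The groups `Ext_R^i(M, C)` vanish for `0 < i ≤ n`. -/
def ExtVanishes (R : Type) [CommRing R] (M C : Type) [AddCommGroup M] [Module R M]
    [AddCommGroup C] [Module R C] (n : ℕ) : Prop :=
  ∀ i < n, Subsingleton (Abelian.Ext (ModuleCat.of R M) (ModuleCat.of R C) (i + 1))

variable {K F M C : Type} [AddCommGroup K] [Module R K] [AddCommGroup F] [Module R F]
  [AddCommGroup M] [Module R M] [AddCommGroup C] [Module R C]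

lemma forall_subsingleton_extGroup_iff :
    (∀ i : ℕ, 0 < i → Subsingleton (extGroup R M C i)) ↔ ∀ n, ExtVanishes R M C n := by
  constructor
  · intro h n i _
    exact (subsingleton_extGroup_succ_iff M C i).1 (h _ i.succ_pos)
  · intro h i hi
    obtain ⟨j, rfl⟩ := Nat.exists_eq_succ_of_ne_zero hi.ne'
    exact (subsingleton_extGroup_succ_iff M C j).2 (h (j + 1) j j.lt_succ_self)

lemma ExtVanishes.mono {m n : ℕ} (h : ExtVanishes R M C n) (hmn : m ≤ n) :
    ExtVanishes R M C m :=
  fun i hi => h i (hi.trans_le hmn)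

lemma extVanishes_zero : ExtVanishes R M C 0 := fun _ hi => absurd hi (Nat.not_lt_zero _)

lemma extVanishes_of_projective [Module.Projective R M] (n : ℕ) : ExtVanishes R M C n :=
  fun i _ => Abelian.Ext.subsingleton_of_projective _ _ i

lemma ExtVanishes.of_equiv (e : M ≃ₗ[R] F) {n : ℕ} (h : ExtVanishes R M C n) :
    ExtVanishes R F C n := by
  intro i hi
  have := h i hi
  refine subsingleton_of_forall_eq 0 fun x => ?_
  have h0 : (Abelian.Ext.mk₀ e.toModuleIso.hom).comp x (zero_add _) = 0 :=
    Subsingleton.elim _ _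
  have h1 := congrArg
    (fun y => (Abelian.Ext.mk₀ e.toModuleIso.inv).comp y (zero_add (i + 1))) h0
  rwa [Abelian.Ext.mk₀_comp_mk₀_assoc, Iso.inv_hom_id, Abelian.Ext.mk₀_id_comp,
    Abelian.Ext.comp_zero] at h1

section ShortExact

variable {f : K →ₗ[R] F} {g : F →ₗ[R] M}

lemma shortExact_moduleCatMk (hf : Function.Injective f) (hfg : Function.Exact f g)
    (hg : Function.Surjective g) :
    (ShortComplex.moduleCatMk f g hfg.linearMap_comp_eq_zero).ShortExact where
  exact := (ShortComplex.ShortExact.moduleCat_exact_iff_function_exact _).2 hfg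
  mono_f := (ModuleCat.mono_iff_injective _).2 hf
  epi_g := (ModuleCat.epi_iff_surjective _).2 hg

lemma ExtVanishes.lcomp_surjective (hf : Function.Injective f) (hfg : Function.Exact f g)
    (hg : Function.Surjective g) (hM : ExtVanishes R M C 1) :
    Function.Surjective (LinearMap.lcomp R C f) := by
  intro φ
  have := hM 0 one_pos
  obtain ⟨x, hx⟩ := Abelian.Ext.contravariant_sequence_exact₁ (shortExact_moduleCatMk hf hfg hg)
    (ModuleCat.of R C) (Abelian.Ext.mk₀ (ModuleCat.ofHom φ)) (n₁ := 1) rfl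
    (this.elim _ _)
  obtain ⟨ψ, rfl⟩ := (Abelian.Ext.mk₀_bijective _ _).2 x
  rw [Abelian.Ext.mk₀_comp_mk₀] at hx
  exact ⟨ψ.hom, congrArg ModuleCat.Hom.hom ((Abelian.Ext.mk₀_bijective _ _).1 hx)⟩

lemma ExtVanishes.left (hf : Function.Injective f) (hfg : Function.Exact f g)
    (hg : Function.Surjective g) {n : ℕ} (hF : ExtVanishes R F C n)
    (hM : ExtVanishes R M C (n + 1)) : ExtVanishes R K C n := by
  intro i hi
  have h1 := hF i hi
  have h2 := hM (i + 1) (Nat.succ_lt_succ hi)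
  refine subsingleton_of_forall_eq 0 fun x => ?_
  obtain ⟨y, rfl⟩ := Abelian.Ext.contravariant_sequence_exact₁
    (shortExact_moduleCatMk hf hfg hg) (ModuleCat.of R C) x (add_comm 1 (i + 1)) (h2.elim _ _)
  rw [show y = 0 from h1.elim _ _]
  apply Abelian.Ext.comp_zero

lemma ExtVanishes.right (hf : Function.Injective f) (hfg : Function.Exact f g)
    (hg : Function.Surjective g) {n : ℕ} (hK : ExtVanishes R K C n)
    (hF : ExtVanishes R F C (n + 1)) (hsurj : Function.Surjective (LinearMap.lcomp R C f)) :
    ExtVanishes R M C (n + 1) := by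
  intro i hi
  have h1 := hF i hi
  refine subsingleton_of_forall_eq 0 fun x => ?_
  obtain ⟨y, rfl⟩ := Abelian.Ext.contravariant_sequence_exact₃
    (shortExact_moduleCatMk hf hfg hg) (ModuleCat.of R C) x (h1.elim _ _) (add_comm 1 i)
  rcases i with _ | i
  · obtain ⟨φ, rfl⟩ := (Abelian.Ext.mk₀_bijective _ _).2 y
    obtain ⟨ψ, hψ⟩ := hsurj φ.hom
    let ψ' : (ShortComplex.moduleCatMk f g hfg.linearMap_comp_eq_zero).X₂ ⟶ ModuleCat.of R C :=
      ModuleCat.ofHom ψ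
    have : φ = (ShortComplex.moduleCatMk f g hfg.linearMap_comp_eq_zero).f ≫ ψ' :=
      ModuleCat.hom_ext hψ.symm
    rw [this, ← Abelian.Ext.mk₀_comp_mk₀]
    exact (shortExact_moduleCatMk hf hfg hg).extClass_comp_assoc _
  · have := hK i (Nat.lt_of_succ_lt_succ hi)
    rw [show y = 0 from this.elim _ _]
    apply Abelian.Ext.comp_zero

end ShortExact

end ExtVanishing

section TensorHom

variable {k : Type} [Field k] {R1 R2 : Type} [CommRing R1] [CommRing R2]
  [Algebra k R1] [Algebra k R2]
variable {L1 L2 M1 M2 C1 C2 : Type}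
  [AddCommGroup L1] [Module k L1] [Module R1 L1] [IsScalarTower k R1 L1]
  [AddCommGroup L2] [Module k L2] [Module R2 L2] [IsScalarTower k R2 L2]
  [AddCommGroup M1] [Module k M1] [Module R1 M1] [IsScalarTower k R1 M1]
  [AddCommGroup M2] [Module k M2] [Module R2 M2] [IsScalarTower k R2 M2]
  [AddCommGroup C1] [Module k C1] [Module R1 C1] [IsScalarTower k R1 C1]
  [AddCommGroup C2] [Module k C2] [Module R2 C2] [IsScalarTower k R2 C2]

instance isScalarTower_tensorModule : IsScalarTower k (R1 ⊗[k] R2) (M1 ⊗[k] M2) := by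
  refine IsScalarTower.of_algebraMap_smul fun a x => ?_
  induction x using TensorProduct.induction_on with
  | zero => simp
  | tmul m n =>
    rw [Algebra.TensorProduct.algebraMap_apply, tensorModule_smul_tmul, algebraMap_smul,
      one_smul, smul_tmul']
  | add x y hx hy => rw [smul_add, smul_add, hx, hy]

/-- An additive map between tensor products commuting with the action of pure tensors on pure
tensors is linear over the tensor product of the rings. -/
lemma map_tensorModule_smul {X : Type} [AddCommGroup X] [Module (R1 ⊗[k] R2) X]
    (φ : M1 ⊗[k] M2 →+ X)
    (h : ∀ (r1 : R1) (r2 : R2) (m : M1) (n : M2),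
      φ ((r1 • m) ⊗ₜ (r2 • n)) = (r1 ⊗ₜ[k] r2 : R1 ⊗[k] R2) • φ (m ⊗ₜ n))
    (s : R1 ⊗[k] R2) (x : M1 ⊗[k] M2) : φ (s • x) = s • φ x := by
  induction s using TensorProduct.induction_on with
  | zero => simp
  | tmul r1 r2 =>
    induction x using TensorProduct.induction_on with
    | zero => simp
    | tmul m n => rw [tensorModule_smul_tmul, h]
    | add x y hx hy => rw [smul_add, map_add, map_add, hx, hy, smul_add]
  | add s t hs ht => rw [add_smul, map_add, hs, ht, add_smul]

/-- The tensor product of an `R1`-linear and an `R2`-linear map, as an `R1 ⊗[k] R2`-linear map. -/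
noncomputable def tensorMap (k : Type) [Field k] [Algebra k R1] [Algebra k R2]
    [Module k L1] [IsScalarTower k R1 L1] [Module k L2] [IsScalarTower k R2 L2]
    [Module k M1] [IsScalarTower k R1 M1] [Module k M2] [IsScalarTower k R2 M2]
    (f : L1 →ₗ[R1] M1) (g : L2 →ₗ[R2] M2) :
    L1 ⊗[k] L2 →ₗ[R1 ⊗[k] R2] M1 ⊗[k] M2 where
  toFun := TensorProduct.map (f.restrictScalars k) (g.restrictScalars k)
  map_add' := map_add _
  map_smul' := map_tensorModule_smul
    (TensorProduct.map (f.restrictScalars k) (g.restrictScalars k)).toAddMonoidHom fun r1 r2 m n => by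
      simp [tensorModule_smul_tmul]

@[simp]
lemma tensorMap_tmul (f : L1 →ₗ[R1] M1) (g : L2 →ₗ[R2] M2) (x : L1) (y : L2) :
    tensorMap k f g (x ⊗ₜ y) = f x ⊗ₜ g y := rfl

@[ext]
lemma tensorModule_hom_ext {X : Type} [AddCommGroup X] [Module (R1 ⊗[k] R2) X]
    {φ ψ : M1 ⊗[k] M2 →ₗ[R1 ⊗[k] R2] X} (h : ∀ m n, φ (m ⊗ₜ n) = ψ (m ⊗ₜ n)) : φ = ψ := by
  refine LinearMap.ext fun x => ?_
  induction x using TensorProduct.induction_on with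
  | zero => simp
  | tmul m n => exact h m n
  | add x y hx hy => rw [map_add, map_add, hx, hy]

variable (k R1 R2 M1 M2 C1 C2) in
/-- The canonical `k`-linear map
`Hom(M1, C1) ⊗[k] Hom(M2, C2) → Hom(M1 ⊗[k] M2, C1 ⊗[k] C2)`. -/
noncomputable def tensorHom :
    (M1 →ₗ[R1] C1) ⊗[k] (M2 →ₗ[R2] C2) →ₗ[R1 ⊗[k] R2]
      (M1 ⊗[k] M2 →ₗ[R1 ⊗[k] R2] C1 ⊗[k] C2) :=
  let φ : (M1 →ₗ[R1] C1) ⊗[k] (M2 →ₗ[R2] C2) →ₗ[k]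
      (M1 ⊗[k] M2 →ₗ[R1 ⊗[k] R2] C1 ⊗[k] C2) :=
    TensorProduct.lift (LinearMap.mk₂ k (tensorMap k)
      (fun f f' g => by ext; simp [add_tmul])
      (fun a f g => by ext; simp [smul_tmul'])
      (fun f g g' => by ext; simp [tmul_add])
      (fun a f g => by ext; simp))
  { toFun := φ
    map_add' := map_add _
    map_smul' := map_tensorModule_smul φ.toAddMonoidHom fun r1 r2 f g => by
      ext m n
      simp [φ, tensorModule_smul_tmul] }

@[simp]
lemma tensorHom_tmul (f : M1 →ₗ[R1] C1) (g : M2 →ₗ[R2] C2) :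
    tensorHom k R1 R2 M1 M2 C1 C2 (f ⊗ₜ g) = tensorMap k f g := rfl

lemma tensorHom_naturality (u : L1 →ₗ[R1] M1) (v : L2 →ₗ[R2] M2)
    (t : (M1 →ₗ[R1] C1) ⊗[k] (M2 →ₗ[R2] C2)) :
    tensorHom k R1 R2 L1 L2 C1 C2
        (TensorProduct.map (LinearMap.lcomp k C1 u) (LinearMap.lcomp k C2 v) t) =
      (tensorHom k R1 R2 M1 M2 C1 C2 t).comp (tensorMap k u v) := by
  induction t using TensorProduct.induction_on with
  | zero => simp
  | tmul f g => ext; simp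
  | add x y hx hy => rw [map_add, map_add, map_add, hx, hy, LinearMap.add_comp]

lemma tensorMap_comp_tensorMap (u : L1 →ₗ[R1] M1) (v : L2 →ₗ[R2] M2)
    (f : M1 →ₗ[R1] C1) (g : M2 →ₗ[R2] C2) :
    (tensorMap k f g).comp (tensorMap k u v) = tensorMap k (f.comp u) (g.comp v) := by
  ext; simp

lemma tensorMap_surjective {f : L1 →ₗ[R1] M1} {g : L2 →ₗ[R2] M2}
    (hf : Function.Surjective f) (hg : Function.Surjective g) :
    Function.Surjective (tensorMap k f g) :=
  TensorProduct.map_surjective (g := f.restrictScalars k) (g' := g.restrictScalars k) hf hg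

lemma tensorMap_injective {f : L1 →ₗ[R1] M1} {g : L2 →ₗ[R2] M2}
    (hf : Function.Injective f) (hg : Function.Injective g) :
    Function.Injective (tensorMap k f g) :=
  TensorProduct.map_injective_of_flat_flat (f.restrictScalars k) (g.restrictScalars k) hf hg

lemma tensorMap_id_right_exact {f : L1 →ₗ[R1] M1} {g : M1 →ₗ[R1] C1}
    (hfg : Function.Exact f g) :
    Function.Exact (tensorMap k f (LinearMap.id : M2 →ₗ[R2] M2))
      (tensorMap k g (LinearMap.id : M2 →ₗ[R2] M2)) :=
  Module.Flat.rTensor_exact (R := k) M2 (f := f.restrictScalars k) (g := g.restrictScalars k) hfg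

lemma tensorMap_id_left_exact {f : L2 →ₗ[R2] M2} {g : M2 →ₗ[R2] C2}
    (hfg : Function.Exact f g) :
    Function.Exact (tensorMap k (LinearMap.id : M1 →ₗ[R1] M1) f)
      (tensorMap k (LinearMap.id : M1 →ₗ[R1] M1) g) :=
  Module.Flat.lTensor_exact (R := k) M1 (f := f.restrictScalars k) (g := g.restrictScalars k) hfg

/-- Bases of the two factors induce a basis of the tensor product over the tensor product of
the rings. -/
noncomputable def tensorBasis (k : Type) [Field k] [Algebra k R1] [Algebra k R2]
    [Module k M1] [IsScalarTower k R1 M1] [Module k M2] [IsScalarTower k R2 M2]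
    {ι κ : Type} (b1 : Module.Basis ι R1 M1) (b2 : Module.Basis κ R2 M2) :
    Module.Basis (ι × κ) (R1 ⊗[k] R2) (M1 ⊗[k] M2) :=
  let e := (TensorProduct.congr (b1.repr.restrictScalars k) (b2.repr.restrictScalars k)).trans
    (finsuppTensorFinsupp k k R1 R2 ι κ)
  .ofRepr { e with
    map_smul' := map_tensorModule_smul e.toLinearMap.toAddMonoidHom fun r1 r2 m n => by
      ext ⟨i, j⟩
      simp [e, finsuppTensorFinsupp_apply] }

lemma tensorBasis_apply {ι κ : Type} (b1 : Module.Basis ι R1 M1) (b2 : Module.Basis κ R2 M2)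
    (i : ι) (j : κ) : tensorBasis k b1 b2 (i, j) = b1 i ⊗ₜ b2 j := by
  rw [Module.Basis.apply_eq_iff]
  change finsuppTensorFinsupp k k R1 R2 ι κ (b1.repr (b1 i) ⊗ₜ b2.repr (b2 j)) = _
  rw [b1.repr_self, b2.repr_self, finsuppTensorFinsupp_single, Algebra.TensorProduct.one_def]

lemma projective_tensorModule {ι κ : Type} (b1 : Module.Basis ι R1 M1)
    (b2 : Module.Basis κ R2 M2) : Module.Projective (R1 ⊗[k] R2) (M1 ⊗[k] M2) :=
  .of_basis (tensorBasis k b1 b2)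

lemma tensorHom_bijective_of_basis {ι κ : Type} [Finite ι] [Finite κ]
    (b1 : Module.Basis ι R1 M1) (b2 : Module.Basis κ R2 M2) :
    Function.Bijective (tensorHom k R1 R2 M1 M2 C1 C2) := by
  let e1 : (M1 →ₗ[R1] C1) ≃ₗ[k] (ι →₀ C1) :=
    (b1.constr k).symm ≪≫ₗ (Finsupp.linearEquivFunOnFinite k C1 ι).symm
  let e2 : (M2 →ₗ[R2] C2) ≃ₗ[k] (κ →₀ C2) :=
    (b2.constr k).symm ≪≫ₗ (Finsupp.linearEquivFunOnFinite k C2 κ).symm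
  let e : (M1 →ₗ[R1] C1) ⊗[k] (M2 →ₗ[R2] C2) ≃ₗ[k] (ι × κ →₀ C1 ⊗[k] C2) :=
    (TensorProduct.congr e1 e2).trans (finsuppTensorFinsupp k k C1 C2 ι κ)
  let e' : (M1 ⊗[k] M2 →ₗ[R1 ⊗[k] R2] C1 ⊗[k] C2) ≃ₗ[k] (ι × κ →₀ C1 ⊗[k] C2) :=
    ((tensorBasis k b1 b2).constr k).symm ≪≫ₗ
      (Finsupp.linearEquivFunOnFinite k (C1 ⊗[k] C2) (ι × κ)).symm
  have h (t) : e' (tensorHom k R1 R2 M1 M2 C1 C2 t) = e t := by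
    induction t using TensorProduct.induction_on with
    | zero => simp
    | tmul f g =>
      ext ⟨i, j⟩
      simp [e, e', e1, e2, finsuppTensorFinsupp_apply, tensorBasis_apply,
        Finsupp.linearEquivFunOnFinite, Module.Basis.constr]
    | add x y hx hy => rw [map_add, map_add, map_add, hx, hy]
  have h2 : e' ∘ tensorHom k R1 R2 M1 M2 C1 C2 = e := funext h
  exact (Function.Bijective.of_comp_iff' e'.bijective _).1 (h2 ▸ e.bijective)

lemma lcomp_injective_of_surjective {R L M C : Type} [CommRing R] [Algebra k R]
    [AddCommGroup L] [Module R L] [AddCommGroup M] [Module R M] [AddCommGroup C] [Module R C]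
    [Module k C] [IsScalarTower k R C]
    {f : L →ₗ[R] M} (hf : Function.Surjective f) :
    Function.Injective (LinearMap.lcomp k C f) :=
  fun _ _ h => (LinearMap.cancel_right hf).1 h

lemma lcomp_exact {R K L M C : Type} [CommRing R] [Algebra k R] [AddCommGroup K] [Module R K]
    [AddCommGroup L] [Module R L] [AddCommGroup M] [Module R M] [AddCommGroup C] [Module R C]
    [Module k C] [IsScalarTower k R C] {f : K →ₗ[R] L} {g : L →ₗ[R] M}
    (hfg : Function.Exact f g) (hg : Function.Surjective g) :
    Function.Exact (LinearMap.lcomp k C g) (LinearMap.lcomp k C f) := by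
  intro φ
  constructor
  · intro h
    have hle : LinearMap.ker g ≤ LinearMap.ker φ := by
      rw [hfg.linearMap_ker_eq]
      rintro _ ⟨x, rfl⟩
      exact LinearMap.congr_fun h x
    refine ⟨(LinearMap.ker g).liftQ φ hle ∘ₗ (g.quotKerEquivOfSurjective hg).symm, ?_⟩
    ext x
    have : (g.quotKerEquivOfSurjective hg).symm (g x) = (LinearMap.ker g).mkQ x := by
      rw [LinearEquiv.symm_apply_eq]; rfl
    simp [this]
  · rintro ⟨ψ, rfl⟩
    ext x
    simp [hfg.apply_apply_eq_zero]

lemma tensorHom_injective [Module.Finite R1 M1] [Module.Finite R2 M2] :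
    Function.Injective (tensorHom k R1 R2 M1 M2 C1 C2) := by
  obtain ⟨m, p1, hp1⟩ := Module.Finite.exists_fin' R1 M1
  obtain ⟨n, p2, hp2⟩ := Module.Finite.exists_fin' R2 M2
  have h := (tensorHom_bijective_of_basis (k := k) (C1 := C1) (C2 := C2)
    (Pi.basisFun R1 (Fin m)) (Pi.basisFun R2 (Fin n))).1.comp
    (TensorProduct.map_injective_of_flat_flat (LinearMap.lcomp k C1 p1) (LinearMap.lcomp k C2 p2)
      (lcomp_injective_of_surjective hp1) (lcomp_injective_of_surjective hp2))
  intro s t hst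
  apply h
  simp only [Function.comp_apply, tensorHom_naturality, hst]

lemma tensorHom_surjective_of_exact_left {K1 : Type} [AddCommGroup K1] [Module k K1]
    [Module R1 K1] [IsScalarTower k R1 K1] {f : K1 →ₗ[R1] L1} {g : L1 →ₗ[R1] M1}
    (hfg : Function.Exact f g) (hg : Function.Surjective g)
    (hK : Function.Injective (tensorHom k R1 R2 K1 M2 C1 C2))
    (hL : Function.Surjective (tensorHom k R1 R2 L1 M2 C1 C2)) :
    Function.Surjective (tensorHom k R1 R2 M1 M2 C1 C2) := by
  intro h
  obtain ⟨t, ht⟩ := hL (h.comp (tensorMap k g LinearMap.id))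
  have h0 : TensorProduct.map (LinearMap.lcomp k C1 f) (LinearMap.lcomp k C2 LinearMap.id) t
      = 0 := by
    apply hK
    rw [tensorHom_naturality, ht, map_zero]
    ext m n
    simp [hfg.apply_apply_eq_zero]
  obtain ⟨s, rfl⟩ := (Module.Flat.rTensor_exact (R := k) (M2 →ₗ[R2] C2)
    (lcomp_exact (k := k) (C := C1) hfg hg) t).1 h0
  refine ⟨s, (LinearMap.cancel_right (tensorMap_surjective (g := LinearMap.id) hg
    Function.surjective_id)).1 ?_⟩
  rw [← ht, ← tensorHom_naturality]
  rfl

lemma tensorHom_surjective_of_exact_right {K2 : Type} [AddCommGroup K2] [Module k K2]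
    [Module R2 K2] [IsScalarTower k R2 K2] {f : K2 →ₗ[R2] L2} {g : L2 →ₗ[R2] M2}
    (hfg : Function.Exact f g) (hg : Function.Surjective g)
    (hK : Function.Injective (tensorHom k R1 R2 M1 K2 C1 C2))
    (hL : Function.Surjective (tensorHom k R1 R2 M1 L2 C1 C2)) :
    Function.Surjective (tensorHom k R1 R2 M1 M2 C1 C2) := by
  intro h
  obtain ⟨t, ht⟩ := hL (h.comp (tensorMap k LinearMap.id g))
  have h0 : TensorProduct.map (LinearMap.lcomp k C1 LinearMap.id) (LinearMap.lcomp k C2 f) t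
      = 0 := by
    apply hK
    rw [tensorHom_naturality, ht, map_zero]
    ext m n
    simp [hfg.apply_apply_eq_zero]
  obtain ⟨s, rfl⟩ := (Module.Flat.lTensor_exact (R := k) (M1 →ₗ[R1] C1)
    (lcomp_exact (k := k) (C := C2) hfg hg) t).1 h0
  refine ⟨s, (LinearMap.cancel_right (tensorMap_surjective (f := LinearMap.id)
    Function.surjective_id hg)).1 ?_⟩
  rw [← ht, ← tensorHom_naturality]
  rfl

lemma tensorHom_bijective [IsNoetherianRing R1] [IsNoetherianRing R2] [Module.Finite R1 M1]
    [Module.Finite R2 M2] : Function.Bijective (tensorHom k R1 R2 M1 M2 C1 C2) := by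
  obtain ⟨m, p1, hp1⟩ := Module.Finite.exists_fin' R1 M1
  obtain ⟨n, p2, hp2⟩ := Module.Finite.exists_fin' R2 M2
  refine ⟨tensorHom_injective, ?_⟩
  refine tensorHom_surjective_of_exact_left p1.exact_subtype_ker_map hp1 tensorHom_injective ?_
  refine tensorHom_surjective_of_exact_right p2.exact_subtype_ker_map hp2 tensorHom_injective ?_
  exact (tensorHom_bijective_of_basis (Pi.basisFun R1 (Fin m)) (Pi.basisFun R2 (Fin n))).2

lemma lcomp_tensorMap_surjective_iff {u : L1 →ₗ[R1] M1} {v : L2 →ₗ[R2] M2}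
    (hM : Function.Bijective (tensorHom k R1 R2 M1 M2 C1 C2))
    (hL : Function.Bijective (tensorHom k R1 R2 L1 L2 C1 C2)) :
    Function.Surjective (LinearMap.lcomp (R1 ⊗[k] R2) (C1 ⊗[k] C2) (tensorMap k u v)) ↔
      Function.Surjective
        (TensorProduct.map (LinearMap.lcomp k C1 u) (LinearMap.lcomp k C2 v)) := by
  have h : LinearMap.lcomp (R1 ⊗[k] R2) (C1 ⊗[k] C2) (tensorMap k u v) ∘
      tensorHom k R1 R2 M1 M2 C1 C2 = tensorHom k R1 R2 L1 L2 C1 C2 ∘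
        TensorProduct.map (LinearMap.lcomp k C1 u) (LinearMap.lcomp k C2 v) :=
    funext fun t => (tensorHom_naturality u v t).symm
  rw [← Function.Surjective.of_comp_iff _ hM.2, h, Function.Surjective.of_comp_iff' hL]

lemma surjective_right_of_map_id_surjective {V W H : Type} [AddCommGroup V] [Module k V]
    [AddCommGroup W] [Module k W] [AddCommGroup H] [Module k H] [Nontrivial H] {f : V →ₗ[k] W}
    (h : Function.Surjective (TensorProduct.map (LinearMap.id : H →ₗ[k] H) f)) :
    Function.Surjective f :=
  (Module.FaithfullyFlat.lTensor_surjective_iff_surjective k H f).1 h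

lemma surjective_left_of_map_id_surjective {V W H : Type} [AddCommGroup V] [Module k V]
    [AddCommGroup W] [Module k W] [AddCommGroup H] [Module k H] [Nontrivial H] {f : V →ₗ[k] W}
    (h : Function.Surjective (TensorProduct.map f (LinearMap.id : H →ₗ[k] H))) :
    Function.Surjective f :=
  (Module.FaithfullyFlat.lTensor_surjective_iff_surjective k H f).1
    ((LinearMap.lTensor_surj_iff_rTensor_surj H f).2 h)

lemma injective_right_of_map_id_injective {V W H : Type} [AddCommGroup V] [Module k V]
    [AddCommGroup W] [Module k W] [AddCommGroup H] [Module k H] [Nontrivial H] {f : V →ₗ[k] W}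
    (h : Function.Injective (TensorProduct.map (LinearMap.id : H →ₗ[k] H) f)) :
    Function.Injective f :=
  (Module.FaithfullyFlat.lTensor_injective_iff_injective k H f).1 h

lemma injective_left_of_map_id_injective {V W H : Type} [AddCommGroup V] [Module k V]
    [AddCommGroup W] [Module k W] [AddCommGroup H] [Module k H] [Nontrivial H] {f : V →ₗ[k] W}
    (h : Function.Injective (TensorProduct.map f (LinearMap.id : H →ₗ[k] H))) :
    Function.Injective f :=
  (Module.FaithfullyFlat.lTensor_injective_iff_injective k H f).1
    ((LinearMap.lTensor_inj_iff_rTensor_inj H f).2 h)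

section Noetherian

variable [IsNoetherianRing R1] [IsNoetherianRing R2]

variable (R1 C1 C2) in
lemma ExtVanishes.tensor_of_left [Module.Finite R2 M2] (n : ℕ)
    (hF : ∀ m : ℕ, ExtVanishes (R1 ⊗[k] R2) ((Fin m → R1) ⊗[k] M2) (C1 ⊗[k] C2) n) :
    ∀ (M1 : Type) [AddCommGroup M1] [Module k M1] [Module R1 M1] [IsScalarTower k R1 M1]
      [Module.Finite R1 M1], ExtVanishes R1 M1 C1 n →
      ExtVanishes (R1 ⊗[k] R2) (M1 ⊗[k] M2) (C1 ⊗[k] C2) n := by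
  induction n with
  | zero => exact fun _ _ _ _ _ _ _ => extVanishes_zero
  | succ n ih =>
    intro M1 _ _ _ _ _ h
    obtain ⟨m, p, hp⟩ := Module.Finite.exists_fin' R1 M1
    have hι := (LinearMap.ker p).injective_subtype
    have hex := p.exact_subtype_ker_map
    refine ExtVanishes.right (f := tensorMap k (LinearMap.ker p).subtype LinearMap.id)
      (g := tensorMap k p LinearMap.id) (tensorMap_injective hι Function.injective_id)
      (tensorMap_id_right_exact hex) (tensorMap_surjective hp Function.surjective_id)
      (ih (fun m => (hF m).mono n.le_succ) _
        (ExtVanishes.left hι hex hp (extVanishes_of_projective n) h)) (hF m) ?_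
    rw [lcomp_tensorMap_surjective_iff tensorHom_bijective tensorHom_bijective]
    refine TensorProduct.map_surjective ?_ Function.surjective_id
    exact ExtVanishes.lcomp_surjective hι hex hp (h.mono (Nat.succ_le_succ n.zero_le))

variable (R2 C1 C2) in
lemma ExtVanishes.tensor_of_right [Module.Finite R1 M1] (n : ℕ)
    (hF : ∀ m : ℕ, ExtVanishes (R1 ⊗[k] R2) (M1 ⊗[k] (Fin m → R2)) (C1 ⊗[k] C2) n) :
    ∀ (M2 : Type) [AddCommGroup M2] [Module k M2] [Module R2 M2] [IsScalarTower k R2 M2]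
      [Module.Finite R2 M2], ExtVanishes R2 M2 C2 n →
      ExtVanishes (R1 ⊗[k] R2) (M1 ⊗[k] M2) (C1 ⊗[k] C2) n := by
  induction n with
  | zero => exact fun _ _ _ _ _ _ _ => extVanishes_zero
  | succ n ih =>
    intro M2 _ _ _ _ _ h
    obtain ⟨m, p, hp⟩ := Module.Finite.exists_fin' R2 M2
    have hι := (LinearMap.ker p).injective_subtype
    have hex := p.exact_subtype_ker_map
    refine ExtVanishes.right (f := tensorMap k LinearMap.id (LinearMap.ker p).subtype)
      (g := tensorMap k LinearMap.id p) (tensorMap_injective Function.injective_id hι)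
      (tensorMap_id_left_exact hex) (tensorMap_surjective Function.surjective_id hp)
      (ih (fun m => (hF m).mono n.le_succ) _
        (ExtVanishes.left hι hex hp (extVanishes_of_projective n) h)) (hF m) ?_
    rw [lcomp_tensorMap_surjective_iff tensorHom_bijective tensorHom_bijective]
    exact TensorProduct.map_surjective Function.surjective_id
      (ExtVanishes.lcomp_surjective hι hex hp (h.mono (Nat.succ_le_succ n.zero_le)))

variable (k R1) in
lemma ExtVanishes.free_tensor [Module.Finite R2 M2] {n : ℕ} (h : ExtVanishes R2 M2 C2 n)
    (m : ℕ) : ExtVanishes (R1 ⊗[k] R2) ((Fin m → R1) ⊗[k] M2) (C1 ⊗[k] C2) n :=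
  ExtVanishes.tensor_of_right R2 C1 C2 n (fun m' =>
    have := projective_tensorModule (k := k) (Pi.basisFun R1 (Fin m)) (Pi.basisFun R2 (Fin m'))
    extVanishes_of_projective n) M2 h

variable (k R2) in
lemma ExtVanishes.tensor_free [Module.Finite R1 M1] {n : ℕ} (h : ExtVanishes R1 M1 C1 n)
    (m : ℕ) : ExtVanishes (R1 ⊗[k] R2) (M1 ⊗[k] (Fin m → R2)) (C1 ⊗[k] C2) n :=
  ExtVanishes.tensor_of_left R1 C1 C2 n (fun m' =>
    have := projective_tensorModule (k := k) (Pi.basisFun R1 (Fin m')) (Pi.basisFun R2 (Fin m))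
    extVanishes_of_projective n) M1 h

lemma ExtVanishes.tensor [Module.Finite R1 M1] [Module.Finite R2 M2] {n : ℕ}
    (h1 : ExtVanishes R1 M1 C1 n) (h2 : ExtVanishes R2 M2 C2 n) :
    ExtVanishes (R1 ⊗[k] R2) (M1 ⊗[k] M2) (C1 ⊗[k] C2) n :=
  ExtVanishes.tensor_of_left R1 C1 C2 n (h2.free_tensor k R1) M1 h1

lemma ExtVanishes.left_of_tensor [Module.Finite R2 M2] [Nontrivial (M2 →ₗ[R2] C2)] (n : ℕ)
    (hF : ∀ m : ℕ, ExtVanishes (R1 ⊗[k] R2) ((Fin m → R1) ⊗[k] M2) (C1 ⊗[k] C2) n) :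
    ∀ (M1 : Type) [AddCommGroup M1] [Module k M1] [Module R1 M1] [IsScalarTower k R1 M1]
      [Module.Finite R1 M1], ExtVanishes (R1 ⊗[k] R2) (M1 ⊗[k] M2) (C1 ⊗[k] C2) (n + 1) →
      ExtVanishes R1 M1 C1 (n + 1) := by
  induction n with
  | zero => ?_
  | succ n ih => ?_
  all_goals
    intro M1 _ _ _ _ _ h
    obtain ⟨m, p, hp⟩ := Module.Finite.exists_fin' R1 M1
    have hι := (LinearMap.ker p).injective_subtype
    have hex := p.exact_subtype_ker_map
    have hι' := tensorMap_injective (k := k) hι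
      (g := (LinearMap.id : M2 →ₗ[R2] M2)) Function.injective_id
    have hex' := tensorMap_id_right_exact (k := k) (R2 := R2) (M2 := M2) hex
    have hp' := tensorMap_surjective (k := k) hp
      (g := (LinearMap.id : M2 →ₗ[R2] M2)) Function.surjective_id
    have hsurj := ExtVanishes.lcomp_surjective (f := tensorMap k (LinearMap.ker p).subtype LinearMap.id)
      (g := tensorMap k p LinearMap.id) hι' hex' hp'
      (h.mono (Nat.succ_le_succ (Nat.zero_le _)))
    rw [lcomp_tensorMap_surjective_iff tensorHom_bijective tensorHom_bijective] at hsurj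
    refine ExtVanishes.right hι hex hp ?_ (extVanishes_of_projective _)
      (surjective_left_of_map_id_surjective hsurj)
  · exact extVanishes_zero
  · exact ih (fun m => (hF m).mono n.le_succ) _ (ExtVanishes.left hι' hex' hp' (hF m) h)

lemma ExtVanishes.right_of_tensor [Module.Finite R1 M1] [Nontrivial (M1 →ₗ[R1] C1)] (n : ℕ)
    (hF : ∀ m : ℕ, ExtVanishes (R1 ⊗[k] R2) (M1 ⊗[k] (Fin m → R2)) (C1 ⊗[k] C2) n) :
    ∀ (M2 : Type) [AddCommGroup M2] [Module k M2] [Module R2 M2] [IsScalarTower k R2 M2]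
      [Module.Finite R2 M2], ExtVanishes (R1 ⊗[k] R2) (M1 ⊗[k] M2) (C1 ⊗[k] C2) (n + 1) →
      ExtVanishes R2 M2 C2 (n + 1) := by
  induction n with
  | zero => ?_
  | succ n ih => ?_
  all_goals
    intro M2 _ _ _ _ _ h
    obtain ⟨m, p, hp⟩ := Module.Finite.exists_fin' R2 M2
    have hι := (LinearMap.ker p).injective_subtype
    have hex := p.exact_subtype_ker_map
    have hι' := tensorMap_injective (k := k)
      (f := (LinearMap.id : M1 →ₗ[R1] M1)) Function.injective_id hι
    have hex' := tensorMap_id_left_exact (k := k) (R1 := R1) (M1 := M1) hex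
    have hp' := tensorMap_surjective (k := k)
      (f := (LinearMap.id : M1 →ₗ[R1] M1)) Function.surjective_id hp
    have hsurj := ExtVanishes.lcomp_surjective hι' hex' hp'
      (h.mono (Nat.succ_le_succ (Nat.zero_le _)))
    rw [lcomp_tensorMap_surjective_iff tensorHom_bijective tensorHom_bijective] at hsurj
    refine ExtVanishes.right hι hex hp ?_ (extVanishes_of_projective _)
      (surjective_right_of_map_id_surjective hsurj)
  · exact extVanishes_zero
  · exact ih (fun m => (hF m).mono n.le_succ) _ (ExtVanishes.left hι' hex' hp' (hF m) h)

lemma ExtVanishes.of_tensor [Module.Finite R1 M1] [Module.Finite R2 M2]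
    [Nontrivial (M1 →ₗ[R1] C1)] [Nontrivial (M2 →ₗ[R2] C2)] {n : ℕ}
    (h : ExtVanishes (R1 ⊗[k] R2) (M1 ⊗[k] M2) (C1 ⊗[k] C2) n) :
    ExtVanishes R1 M1 C1 n ∧ ExtVanishes R2 M2 C2 n := by
  induction n with
  | zero => exact ⟨extVanishes_zero, extVanishes_zero⟩
  | succ n ih =>
    obtain ⟨h1, h2⟩ := ih (h.mono n.le_succ)
    exact ⟨ExtVanishes.left_of_tensor n (h2.free_tensor k R1) M1 h,
      ExtVanishes.right_of_tensor n (h1.tensor_free k R2) M2 h⟩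

end Noetherian

lemma bijective_of_tensorMap_bijective [Nontrivial L1] [Nontrivial L2] {f : L1 →ₗ[R1] M1}
    {g : L2 →ₗ[R2] M2} (h : Function.Bijective (tensorMap k f g)) :
    Function.Bijective f ∧ Function.Bijective g := by
  have hl : tensorMap k f g = (tensorMap k f LinearMap.id).comp (tensorMap k LinearMap.id g) := by
    rw [tensorMap_comp_tensorMap]; rfl
  have hr : tensorMap k f g = (tensorMap k LinearMap.id g).comp (tensorMap k f LinearMap.id) := by
    rw [tensorMap_comp_tensorMap]; rfl
  have hf : Function.Injective f :=
    injective_left_of_map_id_injective (f := f.restrictScalars k) (H := L2)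
      (Function.Injective.of_comp (f := tensorMap k LinearMap.id g) (by rw [hr] at h; exact h.1))
  have hg : Function.Injective g :=
    injective_right_of_map_id_injective (f := g.restrictScalars k) (H := L1)
      (Function.Injective.of_comp (f := tensorMap k f LinearMap.id) (by rw [hl] at h; exact h.1))
  have := hf.nontrivial
  have := hg.nontrivial
  exact ⟨⟨hf, surjective_left_of_map_id_surjective (f := f.restrictScalars k) (H := M2)
      (Function.Surjective.of_comp (g := tensorMap k LinearMap.id g) (by
        rw [hl] at h; exact h.2))⟩,
    ⟨hg, surjective_right_of_map_id_surjective (f := g.restrictScalars k) (H := M1)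
      (Function.Surjective.of_comp (g := tensorMap k f LinearMap.id) (by
        rw [hr] at h; exact h.2))⟩⟩

section Biduality

/-- The biduality map `M → Hom_R(Hom_R(M, C), C)`. -/
abbrev biduality (R C M : Type) [CommRing R] [AddCommGroup C] [Module R C] [AddCommGroup M]
    [Module R M] : M →ₗ[R] ((M →ₗ[R] C) →ₗ[R] C) :=
  (LinearMap.id : (M →ₗ[R] C) →ₗ[R] (M →ₗ[R] C)).flip

lemma nontrivial_of_biduality_injective {R C M : Type} [CommRing R] [AddCommGroup C] [Module R C]
    [AddCommGroup M] [Module R M] [Nontrivial M] (h : Function.Injective (biduality R C M)) :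
    Nontrivial (M →ₗ[R] C) := by
  by_contra hM
  have := not_nontrivial_iff_subsingleton.1 hM
  exact not_subsingleton M h.subsingleton

variable [IsNoetherianRing R1] [IsNoetherianRing R2] [Module.Finite R1 M1] [Module.Finite R2 M2]
  [Module.Finite R1 C1] [Module.Finite R2 C2]

variable (k R1 R2 M1 M2 C1 C2) in
lemma biduality_tensor_bijective_iff :
    Function.Bijective (biduality (R1 ⊗[k] R2) (C1 ⊗[k] C2) (M1 ⊗[k] M2)) ↔
      Function.Bijective (tensorMap k (biduality R1 C1 M1) (biduality R2 C2 M2)) := by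
  let e := LinearEquiv.ofBijective (tensorHom k R1 R2 M1 M2 C1 C2) tensorHom_bijective
  let e' := e.congrLeft (C1 ⊗[k] C2) (R1 ⊗[k] R2)
  let e'' := LinearEquiv.ofBijective
    (tensorHom k R1 R2 (M1 →ₗ[R1] C1) (M2 →ₗ[R2] C2) C1 C2) tensorHom_bijective
  have h : biduality (R1 ⊗[k] R2) (C1 ⊗[k] C2) (M1 ⊗[k] M2) =
      (e''.trans e').toLinearMap.comp
        (tensorMap k (biduality R1 C1 M1) (biduality R2 C2 M2)) := by
    ext m n φ
    obtain ⟨t, rfl⟩ := e.surjective φ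
    change tensorHom k R1 R2 M1 M2 C1 C2 t (m ⊗ₜ n) =
      (tensorMap k (biduality R1 C1 M1 m) (biduality R2 C2 M2 n)) (e.symm (e t))
    rw [e.symm_apply_apply]
    induction t using TensorProduct.induction_on with
    | zero => simp
    | tmul f g => simp
    | add x y hx hy => rw [map_add, map_add, LinearMap.add_apply, hx, hy]
  rw [h]
  exact Function.Bijective.of_comp_iff' (e''.trans e').bijective _

end Biduality

end TensorHom
open TensorProduct in
/-- Let `k` be a field, `R1`, `R2` nonzero commutative noetherian `k`-algebras,
`C1`, `C2` semidualizing modules over `R1`, `R2` respectively, and `N1`, `N2` finitely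
generated modules over `R1`, `R2` respectively.  If `N1` is totally `C1`-reflexive and
`N2` is totally `C2`-reflexive, then `N1 ⊗[k] N2` is totally `(C1 ⊗[k] C2)`-reflexive;
conversely, if `N1 ≠ 0 ≠ N2` and `N1 ⊗[k] N2` is totally `(C1 ⊗[k] C2)`-reflexive, then
`N1` is totally `C1`-reflexive and `N2` is totally `C2`-reflexive. -/
theorem isTotallyReflexive_tensorProduct
    (k : Type) [Field k] (R1 R2 : Type) [CommRing R1] [CommRing R2]
    [Algebra k R1] [Algebra k R2] [Nontrivial R1] [Nontrivial R2]
    [IsNoetherianRing R1] [IsNoetherianRing R2]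
    (C1 C2 : Type) [AddCommGroup C1] [Module k C1] [Module R1 C1] [IsScalarTower k R1 C1]
    [AddCommGroup C2] [Module k C2] [Module R2 C2] [IsScalarTower k R2 C2]
    (hC1 : IsSemidualizing R1 C1) (hC2 : IsSemidualizing R2 C2)
    (N1 N2 : Type) [AddCommGroup N1] [Module k N1] [Module R1 N1] [IsScalarTower k R1 N1]
    [AddCommGroup N2] [Module k N2] [Module R2 N2] [IsScalarTower k R2 N2]
    [Module.Finite R1 N1] [Module.Finite R2 N2] :
    (IsTotallyReflexive R1 C1 N1 → IsTotallyReflexive R2 C2 N2 →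
      IsTotallyReflexive (R1 ⊗[k] R2) (C1 ⊗[k] C2) (N1 ⊗[k] N2)) ∧
    (Nontrivial N1 → Nontrivial N2 →
      IsTotallyReflexive (R1 ⊗[k] R2) (C1 ⊗[k] C2) (N1 ⊗[k] N2) →
      IsTotallyReflexive R1 C1 N1 ∧ IsTotallyReflexive R2 C2 N2) := by
  have : Module.Finite R1 C1 := hC1.1
  have : Module.Finite R2 C2 := hC2.1
  have e : ((N1 →ₗ[R1] C1) ⊗[k] (N2 →ₗ[R2] C2)) ≃ₗ[R1 ⊗[k] R2]
      (N1 ⊗[k] N2 →ₗ[R1 ⊗[k] R2] C1 ⊗[k] C2) :=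
    LinearEquiv.ofBijective (tensorHom k R1 R2 N1 N2 C1 C2) tensorHom_bijective
  simp only [IsTotallyReflexive, forall_subsingleton_extGroup_iff]
  refine ⟨fun ⟨hb1, h1, h1'⟩ ⟨hb2, h2, h2'⟩ => ⟨?_, fun n => (h1 n).tensor (h2 n),
    fun n => ((h1' n).tensor (h2' n)).of_equiv e⟩, fun _ _ ⟨hb, h, h'⟩ => ?_⟩
  · exact (biduality_tensor_bijective_iff k R1 R2 N1 N2 C1 C2).2
      ⟨tensorMap_injective hb1.1 hb2.1, tensorMap_surjective hb1.2 hb2.2⟩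
  · obtain ⟨hb1, hb2⟩ := bijective_of_tensorMap_bijective
      ((biduality_tensor_bijective_iff k R1 R2 N1 N2 C1 C2).1 hb)
    have := nontrivial_of_biduality_injective hb1.1
    have := nontrivial_of_biduality_injective hb2.1
    have := hb1.1.nontrivial
    have := hb2.1.nontrivial
    have hN (n : ℕ) := (h n).of_tensor
    have hN' (n : ℕ) := ((h' n).of_equiv e.symm).of_tensor
    exact ⟨⟨hb1, fun n => (hN n).1, fun n => (hN' n).1⟩,
      ⟨hb2, fun n => (hN n).2, fun n => (hN' n).2⟩⟩
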